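/- For every ε > 0, the proportion, among all n! permutations π of [n], of those containing a pair of block twins of length ⌈(2 + ε)·log n / log log n⌉ tends to 0 as n → ∞. -/

import Mathlib

/-- `f` and `g` enumerate (in increasing order of positions) a pair of twins in the
permutation `π`: both are strictly monotone position sequences, with disjoint ranges,
and the two subsequences of `π` are order-isomorphic. -/
def IsTwinPair {n : ℕ} (π : Equiv.Perm (Fin n)) {k : ℕ} (f g : Fin k → Fin n) : Prop :=
  StrictMono f ∧ StrictMono g ∧ (∀ a b : Fin k, f a ≠ g b) ∧
    (∀ a b : Fin k, π (f a) < π (f b) ↔ π (g a) < π (g b))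

/-- `π` contains a pair of twins of length `k`. -/
def HasTwins {n : ℕ} (π : Equiv.Perm (Fin n)) (k : ℕ) : Prop :=
  ∃ f g : Fin k → Fin n, IsTwinPair π f g

/-- `t(π)`: the maximum length of a pair of twins in `π`. -/
noncomputable def twinLen {n : ℕ} (π : Equiv.Perm (Fin n)) : ℕ :=
  sSup {k | HasTwins π k}

/-- The range of `f` is a block (a set of consecutive positions). -/
def IsBlockFun {n k : ℕ} (f : Fin k → Fin n) : Prop :=
  ∃ s : ℕ, ∀ a : Fin k, (f a : ℕ) = s + (a : ℕ)

/-- `π` contains a pair of block twins of length `k`. -/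
def HasBlockTwins {n : ℕ} (π : Equiv.Perm (Fin n)) (k : ℕ) : Prop :=
  ∃ f g : Fin k → Fin n, IsTwinPair π f g ∧ IsBlockFun f ∧ IsBlockFun g

/-- The union of the ranges of `f` and `g` is a block (a set of `2k` consecutive positions). -/
def IsTightPair {n k : ℕ} (f g : Fin k → Fin n) : Prop :=
  ∃ s : ℕ, ∀ x : Fin n,
    ((∃ a, f a = x) ∨ (∃ a, g a = x)) ↔ (s ≤ (x : ℕ) ∧ (x : ℕ) < s + 2 * k)

/-- `π` contains a pair of tight twins of length `k`. -/
def HasTightTwins {n : ℕ} (π : Equiv.Perm (Fin n)) (k : ℕ) : Prop :=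
  ∃ f g : Fin k → Fin n, IsTwinPair π f g ∧ IsTightPair f g

/-- A permutation preserving the order pulled back along `w` from a finite chain is trivial. -/
lemma Equiv.Perm.eq_of_lt_iff_lt {α : Type*} {n : ℕ} (w : α → Fin n)
    (hw : Function.Injective w) (ρ : Equiv.Perm α)
    (h : ∀ a b, w (ρ a) < w (ρ b) ↔ w a < w b) (a : α) : ρ a = a := by
  suffices H : ∀ m : Fin n, ∀ a, w a = m → ρ a = a from H _ a rfl
  intro m
  induction m using WellFoundedLT.induction with
  | ind m ih =>
    rintro a rfl
    rcases lt_trichotomy (w (ρ a)) (w a) with hlt | heq | hgt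
    · exact ρ.injective (ih _ hlt _ rfl)
    · exact hw heq
    · have hc : w (ρ.symm a) < w a := by
        rw [← h]
        simpa using hgt
      have := ih _ hc _ rfl
      rw [Equiv.apply_symm_apply] at this
      exact (Equiv.eq_symm_apply ρ).1 this

/-- Given disjoint position sequences `f` and `g` of length `k`, at most a `1 / k!` proportion of
all permutations have `f` and `g` as twins. -/
lemma card_isTwinPair_mul_factorial_le {n k : ℕ} (f g : Fin k → Fin n) :
    Nat.card {π : Equiv.Perm (Fin n) // IsTwinPair π f g} * k.factorial ≤ n.factorial := by
  classical
  by_cases hg : StrictMono g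
  swap
  · have : IsEmpty {π : Equiv.Perm (Fin n) // IsTwinPair π f g} := ⟨fun π => hg π.2.2.1⟩
    simp
  let ι : Fin k ↪ Fin n := ⟨g, hg.injective⟩
  have hcard : Nat.card ({π : Equiv.Perm (Fin n) // IsTwinPair π f g} × Equiv.Perm (Fin k)) ≤
      Nat.card (Equiv.Perm (Fin n)) := by
    refine Nat.card_le_card_of_injective (fun p => p.1.1 * p.2.viaEmbedding ι) ?_
    rintro ⟨⟨π, hπ⟩, σ⟩ ⟨⟨π', hπ'⟩, σ'⟩ h
    have h' : π * σ.viaEmbedding ι = π' * σ'.viaEmbedding ι := h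
    have hf (a : Fin k) : π (f a) = π' (f a) := by
      have hmem : f a ∉ Set.range ι := by
        rintro ⟨b, hb⟩
        exact hπ.2.2.1 a b hb.symm
      simpa [Equiv.Perm.viaEmbedding_apply_of_notMem _ _ _ hmem] using congrArg (· (f a)) h'
    have hgσ (a : Fin k) : π (g (σ a)) = π' (g (σ' a)) := by
      have key (τ : Equiv.Perm (Fin k)) : τ.viaEmbedding ι (g a) = g (τ a) :=
        τ.viaEmbedding_apply ι a
      simpa [key] using congrArg (· (g a)) h'
    have hρ (a : Fin k) : π' (g ((σ' * σ⁻¹) a)) = π (g a) := by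
      simpa using (hgσ (σ⁻¹ a)).symm
    have hσ : σ' * σ⁻¹ = 1 := by
      ext1 a
      refine Equiv.Perm.eq_of_lt_iff_lt (fun x => π' (g x))
        (π'.injective.comp hg.injective) _ (fun a b => ?_) a
      rw [hρ, hρ, ← hπ.2.2.2, hf, hf, hπ'.2.2.2]
    obtain rfl : σ' = σ := mul_inv_eq_one.1 hσ
    obtain rfl : π = π' := mul_right_cancel h'
    rfl
  simpa only [Nat.card_prod, Nat.card_perm, Nat.card_fin] using hcard

/-- Union bound over the two starting positions. -/
lemma card_hasBlockTwins_mul_factorial_le {n k : ℕ} (hk : 0 < k) :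
    Nat.card {π : Equiv.Perm (Fin n) // HasBlockTwins π k} * k.factorial ≤
      n ^ 2 * n.factorial := by
  classical
  let A (p : Fin n × Fin n) : Finset (Equiv.Perm (Fin n)) :=
    {π | ∃ f g : Fin k → Fin n, IsTwinPair π f g ∧
      (∀ a, (f a : ℕ) = p.1 + a) ∧ ∀ a, (g a : ℕ) = p.2 + a}
  have hA (p : Fin n × Fin n) : (A p).card * k.factorial ≤ n.factorial := by
    rcases (A p).eq_empty_or_nonempty with h0 | ⟨π, hπ⟩
    · simp [h0]
    obtain ⟨f, g, -, hf, hg⟩ := (Finset.mem_filter.1 hπ).2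
    refine le_trans (Nat.mul_le_mul_right _ ?_) (card_isTwinPair_mul_factorial_le f g)
    rw [Nat.card_eq_fintype_card, Fintype.card_subtype]
    refine Finset.card_le_card fun π' hπ' => ?_
    obtain ⟨f', g', htw, hf', hg'⟩ := (Finset.mem_filter.1 hπ').2
    obtain rfl : f' = f := funext fun a => Fin.ext ((hf' a).trans (hf a).symm)
    obtain rfl : g' = g := funext fun a => Fin.ext ((hg' a).trans (hg a).symm)
    simpa using htw
  have hsub : ({π | HasBlockTwins π k} : Finset (Equiv.Perm (Fin n))) ⊆
      Finset.univ.biUnion A := by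
    intro π hπ
    obtain ⟨f, g, htw, ⟨s, hs⟩, ⟨t, ht⟩⟩ := (Finset.mem_filter.1 hπ).2
    have hs0 : (f ⟨0, hk⟩ : ℕ) = s := hs _
    have ht0 : (g ⟨0, hk⟩ : ℕ) = t := ht _
    refine Finset.mem_biUnion.2 ⟨(f ⟨0, hk⟩, g ⟨0, hk⟩), Finset.mem_univ _, ?_⟩
    refine Finset.mem_filter.2 ⟨Finset.mem_univ _, f, g, htw, ?_, ?_⟩
    · simpa only [hs0] using hs
    · simpa only [ht0] using ht
  rw [Nat.card_eq_fintype_card, Fintype.card_subtype]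
  calc _ ≤ (∑ p, (A p).card) * k.factorial :=
        Nat.mul_le_mul_right _ ((Finset.card_le_card hsub).trans Finset.card_biUnion_le)
    _ = ∑ p, (A p).card * k.factorial := Finset.sum_mul _ _ _
    _ ≤ ∑ _p : Fin n × Fin n, n.factorial := Finset.sum_le_sum fun p _ => hA p
    _ = n ^ 2 * n.factorial := by simp [sq]

/-- A weak form of Stirling's bound, at a real argument below `k`. -/
lemma inv_factorial_le_exp {k : ℕ} {x : ℝ} (hx : Real.exp 1 ≤ x) (hxk : x ≤ k) :
    ((k.factorial : ℝ))⁻¹ ≤ Real.exp (-(x * (Real.log x - 1))) := by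
  have hx0 : 0 < x := (Real.exp_pos 1).trans_le hx
  have hk0 : (0 : ℝ) < k := hx0.trans_le hxk
  have hlog : 1 ≤ Real.log x := (Real.le_log_iff_exp_le hx0).2 hx
  have hlogk : Real.log x ≤ Real.log k := Real.log_le_log hx0 hxk
  have hpow : (k : ℝ) ^ k = Real.exp (k * Real.log k) := by
    rw [mul_comm, Real.exp_mul, Real.exp_log hk0, Real.rpow_natCast]
  have h := Real.pow_div_factorial_le_exp (k : ℝ) hk0.le k
  rw [hpow, div_eq_mul_inv] at h
  calc ((k.factorial : ℝ))⁻¹ ≤ Real.exp k / Real.exp (k * Real.log k) := by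
        rw [le_div_iff₀ (Real.exp_pos _), mul_comm]
        exact h
    _ = Real.exp (-(k * (Real.log k - 1))) := by
        rw [← Real.exp_sub]
        ring_nf
    _ ≤ _ := by
        refine Real.exp_le_exp.2 (neg_le_neg ?_)
        exact mul_le_mul hxk (by linarith) (by linarith) hk0.le

open Filter in
/-- With `L = log n`, the exponent in Stirling's bound eventually beats `(2 + ε / 2) L`. -/
lemma eventually_le_mul_log_sub_one {ε : ℝ} (hε : 0 < ε) :
    ∀ᶠ L : ℝ in atTop, Real.exp 1 ≤ (2 + ε) * L / Real.log L ∧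
      (2 + ε / 2) * L ≤
        (2 + ε) * L / Real.log L * (Real.log ((2 + ε) * L / Real.log L) - 1) := by
  have hδ : 0 < ε / 2 / (2 + ε) / 2 := by positivity
  have hlog := Real.isLittleO_log_id_atTop.def hδ
  have hy : ∀ᶠ y : ℝ in atTop,
      1 ≤ y ∧ (2 + ε / 2) / (2 + ε) * y ≤ y - Real.log y - 1 ∧ 1 ≤ y - Real.log y - 1 := by
    filter_upwards [hlog, eventually_ge_atTop 1, eventually_ge_atTop (1 / (ε / 2 / (2 + ε) / 2)),
      eventually_ge_atTop (2 : ℝ)] with y h1 h2 h3 h4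
    have hlogy : Real.log y ≤ ε / 2 / (2 + ε) / 2 * y := by
      simpa [abs_of_nonneg (zero_le_one.trans h2), abs_of_nonneg (Real.log_nonneg h2)] using h1
    have h5 : 1 ≤ ε / 2 / (2 + ε) / 2 * y := by
      rwa [div_le_iff₀ hδ, mul_comm] at h3
    have hc : (2 + ε / 2) / (2 + ε) = 1 - 2 * (ε / 2 / (2 + ε) / 2) := by
      field_simp
      ring
    have hc' : 1 / 2 ≤ (2 + ε / 2) / (2 + ε) := by
      rw [div_le_div_iff₀ (by norm_num) (by positivity)]
      linarith
    have h6 : (2 + ε / 2) / (2 + ε) * y ≤ y - Real.log y - 1 := by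
      rw [hc]
      linarith
    refine ⟨h2, h6, le_trans ?_ h6⟩
    nlinarith
  filter_upwards [Real.tendsto_log_atTop.eventually hy, eventually_gt_atTop 0] with L hL hL0
  obtain ⟨h1, h2, h3⟩ := hL
  have hlogL : 0 < Real.log L := by linarith
  have hx : 0 < (2 + ε) * L / Real.log L := by positivity
  have hlogx : Real.log L - Real.log (Real.log L) ≤ Real.log ((2 + ε) * L / Real.log L) := by
    rw [Real.log_div (by positivity) hlogL.ne', Real.log_mul (by positivity) hL0.ne']
    have : 0 ≤ Real.log (2 + ε) := Real.log_nonneg (by linarith)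
    linarith
  refine ⟨(Real.le_log_iff_exp_le hx).1 (by linarith), ?_⟩
  calc (2 + ε / 2) * L
      = (2 + ε) * L / Real.log L * ((2 + ε / 2) / (2 + ε) * Real.log L) := by
        field_simp
    _ ≤ _ := mul_le_mul_of_nonneg_left (by linarith) hx.le

/-- For every $ε > 0$, the proportion of $n$-permutations containing a pair of block twins
of length $⌈(2+ε)\log n/\log\log n⌉$ tends to $0$. -/
theorem random_block_twins_upper (ε : ℝ) (hε : 0 < ε) :
    Filter.Tendsto (fun n : ℕ =>
        (Nat.card {π : Equiv.Perm (Fin n) //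
            HasBlockTwins π ⌈(2 + ε) * Real.log n / Real.log (Real.log n)⌉₊} : ℝ)
          / (Nat.factorial n : ℝ))
      Filter.atTop (nhds 0) := by
  have hlog : Filter.Tendsto (fun n : ℕ => Real.log n) Filter.atTop Filter.atTop :=
    Real.tendsto_log_atTop.comp tendsto_natCast_atTop_atTop
  have hlim : Filter.Tendsto (fun n : ℕ => Real.exp (-(ε / 2 * Real.log n)))
      Filter.atTop (nhds 0) :=
    Real.tendsto_exp_neg_atTop_nhds_zero.comp (hlog.const_mul_atTop (half_pos hε))
  refine squeeze_zero' (Filter.Eventually.of_forall fun n => by positivity) ?_ hlim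
  filter_upwards [hlog.eventually (eventually_le_mul_log_sub_one hε),
    Filter.eventually_gt_atTop 0] with n ⟨hx, hmain⟩ hn
  set x : ℝ := (2 + ε) * Real.log n / Real.log (Real.log n)
  have hk : 0 < ⌈x⌉₊ := Nat.ceil_pos.2 ((Real.exp_pos 1).trans_le hx)
  have hfac := inv_factorial_le_exp hx (Nat.le_ceil x)
  have hcount : (Nat.card {π : Equiv.Perm (Fin n) // HasBlockTwins π ⌈x⌉₊} : ℝ) *
      (⌈x⌉₊.factorial : ℝ) ≤ (n : ℝ) ^ 2 * n.factorial := by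
    exact_mod_cast card_hasBlockTwins_mul_factorial_le hk
  have hn2 : (n : ℝ) ^ 2 = Real.exp (2 * Real.log n) := by
    rw [mul_comm, Real.exp_mul, Real.exp_log (by exact_mod_cast hn)]
    norm_cast
  have hkpos : (0 : ℝ) < ⌈x⌉₊.factorial := by positivity
  calc _ ≤ (n : ℝ) ^ 2 * ((⌈x⌉₊.factorial : ℝ))⁻¹ := by
        rw [div_le_iff₀ (by positivity), mul_right_comm, ← div_eq_mul_inv, le_div_iff₀ hkpos]
        exact hcount
    _ ≤ Real.exp (2 * Real.log n) * Real.exp (-(x * (Real.log x - 1))) := by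
        rw [hn2]
        gcongr
    _ ≤ Real.exp (-(ε / 2 * Real.log n)) := by
        rw [← Real.exp_add]
        exact Real.exp_le_exp.2 (by linarith)
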